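/- arXiv:2305.02527 — 4 statements merged into one kernel-verified Lean document; each statement's English description precedes it below -/
import Mathlib

section
/- Let d ≥ 0 and suppose the delayed composite reward stream has spillover bound d. Then for all integers 1 ≤ a ≤ b, the sum of observed rewards over the interval [a, b) differs from the total reward generated during [a, b) by at most d: −d ≤ ∑_{T=a}^{b−1} x_T − ∑_{t=a}^{b−1} ∑_{τ=0}^{∞} r_t(τ) ≤ d. -/
/-- Reward generated before time `n` that is realized at time `n` or later. -/
noncomputable def pendingReward (r : ℕ → ℕ → ℝ) (n : ℕ) : ℝ :=
  ∑ t ∈ Finset.Ico 1 n, ∑' τ : ℕ, r t (n - t + τ)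

theorem tsum_add_left_eq_add {f : ℕ → ℝ} (hf : Summable f) (k : ℕ) :
    ∑' τ, f (k + τ) = f k + ∑' τ, f (k + 1 + τ) := by
  have h : Summable fun τ => f (k + τ) := by
    simpa only [add_comm] using (summable_nat_add_iff k).2 hf
  rw [h.tsum_eq_zero_add]
  simp only [add_zero, add_assoc, add_comm 1]

theorem pendingReward_nonneg {r : ℕ → ℕ → ℝ} (hr : ∀ t τ, 1 ≤ t → 0 ≤ r t τ) (n : ℕ) :
    0 ≤ pendingReward r n :=
  Finset.sum_nonneg fun _ ht => tsum_nonneg fun _ => hr _ _ (Finset.mem_Ico.1 ht).1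

theorem pendingReward_le_tsum {r : ℕ → ℕ → ℝ} {c : ℕ → ℝ} (hc_nonneg : ∀ k, 0 ≤ c k)
    (hc_summable : Summable c) (h_tail : ∀ t k, 1 ≤ t → (∑' τ : ℕ, r t (k + τ)) ≤ c k)
    (n : ℕ) : pendingReward r n ≤ ∑' k, c k := by
  calc
    pendingReward r n ≤ ∑ t ∈ Finset.Ico 1 n, c (n - t) :=
      Finset.sum_le_sum fun _ ht => h_tail _ _ (Finset.mem_Ico.1 ht).1
    _ = ∑ k ∈ (Finset.Ico 1 n).image (n - ·), c k := by
      refine (Finset.sum_image fun s hs t ht h => ?_).symm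
      simp only [Finset.coe_Ico, Set.mem_Ico] at hs ht h
      omega
    _ ≤ ∑' k, c k := hc_summable.sum_le_tsum _ fun k _ => hc_nonneg k

/-- Conservation of reward: what is pending at time `n` or generated at time `n` is either
observed at time `n` or pending at time `n + 1`. -/
theorem pendingReward_succ {r : ℕ → ℕ → ℝ} (hr : ∀ t, 1 ≤ t → Summable (r t)) {n : ℕ}
    (hn : 1 ≤ n) :
    pendingReward r n + ∑' τ, r n τ =
      ∑ t ∈ Finset.Icc 1 n, r t (n - t) + pendingReward r (n + 1) := by
  have hsplit : pendingReward r n + ∑' τ, r n τ =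
      ∑ t ∈ Finset.Ico 1 (n + 1), ∑' τ, r t (n - t + τ) := by
    simp [pendingReward, Finset.sum_Ico_succ_top hn]
  have hIcc : Finset.Icc 1 n = Finset.Ico 1 (n + 1) := by
    ext t
    simp only [Finset.mem_Icc, Finset.mem_Ico]
    omega
  rw [hsplit, hIcc, pendingReward, ← Finset.sum_add_distrib]
  refine Finset.sum_congr rfl fun t ht => ?_
  obtain ⟨h1, h2⟩ := Finset.mem_Ico.1 ht
  rw [tsum_add_left_eq_add (hr t h1), Nat.sub_add_comm (Nat.lt_succ_iff.1 h2)]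


/-- **Observed versus generated reward over an interval.**
For each time `t ≥ 1`, `r t : ℕ → ℝ` is the nonnegative summable sequence of reward
components generated at time `t`, where `r t τ` is realized at time `t + τ`, and the
observed reward at time `T` is `x T = ∑_{t=1}^{T} r t (T - t)`.  If the stream has
spillover bound `d ≥ 0` (witnessed by a nonnegative summable `c` with `∑' k, c k ≤ d`
and `∑_{τ=k}^∞ r t τ ≤ c k` for all `t ≥ 1`, `k`), then for all `1 ≤ a ≤ b` the sum
of observed rewards over `[a, b)` differs from the total reward generated during
`[a, b)` by at most `d`. -/
theorem observed_minus_generated_bounded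
    (r : ℕ → ℕ → ℝ) (d : ℝ) (hd : 0 ≤ d)
    (hr_nonneg : ∀ t τ, 1 ≤ t → 0 ≤ r t τ)
    (hr_summable : ∀ t, 1 ≤ t → Summable (r t))
    (c : ℕ → ℝ) (hc_nonneg : ∀ k, 0 ≤ c k) (hc_summable : Summable c)
    (hc_sum : ∑' k, c k ≤ d)
    (h_tail : ∀ t k, 1 ≤ t → (∑' τ : ℕ, r t (k + τ)) ≤ c k)
    (x : ℕ → ℝ) (hx : ∀ T, x T = ∑ t ∈ Finset.Icc 1 T, r t (T - t)) :
    ∀ a b : ℕ, 1 ≤ a → a ≤ b →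
      -d ≤ (∑ T ∈ Finset.Ico a b, x T) - (∑ t ∈ Finset.Ico a b, ∑' τ : ℕ, r t τ)
      ∧ (∑ T ∈ Finset.Ico a b, x T) - (∑ t ∈ Finset.Ico a b, ∑' τ : ℕ, r t τ) ≤ d := by
  intro a b ha hab
  have key : (∑ T ∈ Finset.Ico a b, x T) - (∑ t ∈ Finset.Ico a b, ∑' τ : ℕ, r t τ) =
      pendingReward r a - pendingReward r b := by
    induction b, hab using Nat.le_induction with
    | base => simp
    | succ n hn ih =>
      rw [Finset.sum_Ico_succ_top hn, Finset.sum_Ico_succ_top hn, hx n]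
      linarith [pendingReward_succ hr_summable (ha.trans hn)]
  have hle := fun n => (pendingReward_le_tsum hc_nonneg hc_summable h_tail n).trans hc_sum
  have hnn := pendingReward_nonneg hr_nonneg
  rw [key]
  constructor <;> linarith [hle a, hle b, hnn a, hnn b]
end

section
/- Let n ≥ 1 and let z_1, ..., z_n be nonnegative reals. Define the partial sums Z_0 = 0 and Z_k = z_1 + ... + z_k for 1 ≤ k ≤ n. If z_k ≤ max{Z_{k−1}, 1} for every 1 ≤ k ≤ n, then ∑_{k=1}^{n} z_k / √(max{Z_{k−1}, 1}) ≤ (√2 + 1)·√(Z_n). -/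
/-- One step of the counting inequality once the partial sum is positive. -/
lemma div_sqrt_le_mul_sqrt_add_sub_sqrt {Z x : ℝ} (hZ : 0 < Z) (hx : 0 ≤ x) (hxZ : x ≤ Z) :
    x / √Z ≤ (√2 + 1) * (√(Z + x) - √Z) := by
  have ha : 0 < √Z := Real.sqrt_pos.2 hZ
  have hab : √Z ≤ √(Z + x) := Real.sqrt_le_sqrt (by linarith)
  have hb : √(Z + x) ≤ √2 * √Z := by
    rw [← Real.sqrt_mul (by norm_num)]
    exact Real.sqrt_le_sqrt (by linarith)
  have ha2 : √Z ^ 2 = Z := Real.sq_sqrt hZ.le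
  have hb2 : √(Z + x) ^ 2 = Z + x := Real.sq_sqrt (by linarith)
  rw [div_le_iff₀ ha]
  nlinarith [mul_nonneg (sub_nonneg.2 hab) (sub_nonneg.2 hb)]

/-- A nonnegative real that is at most `2` is bounded by a multiple of its square root. -/
lemma le_sqrt_two_add_one_mul_sqrt {x : ℝ} (hx : 0 ≤ x) (hx2 : x ≤ 2) :
    x ≤ (√2 + 1) * √x := by
  have h : √x ≤ √2 := Real.sqrt_le_sqrt hx2
  nlinarith [Real.sq_sqrt hx, Real.sqrt_nonneg x]

/-- **The UCRL2 counting inequality (Appendix C.3 of Jaksch et al.).**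
Let `z 1, ..., z n` be nonnegative reals with partial sums `Z k = z 1 + ⋯ + z k`
(so `Z 0 = 0`).  If `z k ≤ max (Z (k-1)) 1` for every `1 ≤ k ≤ n`, then
`∑_{k=1}^{n} z k / √(max (Z (k-1)) 1) ≤ (√2 + 1) * √(Z n)`. -/
theorem ucrl2_counting_inequality
    (n : ℕ) (hn : 1 ≤ n) (z : ℕ → ℝ)
    (hz_nonneg : ∀ k, 1 ≤ k → k ≤ n → 0 ≤ z k)
    (hz_le : ∀ k, 1 ≤ k → k ≤ n →
      z k ≤ max (∑ i ∈ Finset.Icc 1 (k - 1), z i) 1) :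
    ∑ k ∈ Finset.Icc 1 n,
        z k / Real.sqrt (max (∑ i ∈ Finset.Icc 1 (k - 1), z i) 1)
      ≤ (Real.sqrt 2 + 1) * Real.sqrt (∑ i ∈ Finset.Icc 1 n, z i) := by
  suffices h : ∀ m ≤ n, 0 ≤ ∑ i ∈ Finset.Icc 1 m, z i ∧
      (∑ i ∈ Finset.Icc 1 m, z i ≤ 1 →
        ∑ k ∈ Finset.Icc 1 m, z k / Real.sqrt (max (∑ i ∈ Finset.Icc 1 (k - 1), z i) 1)
          = ∑ i ∈ Finset.Icc 1 m, z i) ∧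
      ∑ k ∈ Finset.Icc 1 m, z k / Real.sqrt (max (∑ i ∈ Finset.Icc 1 (k - 1), z i) 1)
        ≤ (Real.sqrt 2 + 1) * Real.sqrt (∑ i ∈ Finset.Icc 1 m, z i) from (h n le_rfl).2.2
  intro m
  induction m with
  | zero => simp
  | succ m ih =>
    intro hm
    obtain ⟨h_nonneg, h_eq, h_le⟩ := ih (by omega)
    have hz0 := hz_nonneg (m + 1) (by omega) hm
    have hz1 := hz_le (m + 1) (by omega) hm
    simp only [Finset.sum_Icc_succ_top (Nat.le_add_left 1 m), Nat.add_sub_cancel] at hz1 ⊢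
    refine ⟨by linarith, ?_⟩
    rcases le_or_gt (∑ i ∈ Finset.Icc 1 m, z i) 1 with hZ | hZ
    · rw [max_eq_right hZ] at hz1 ⊢
      rw [h_eq hZ, Real.sqrt_one, div_one]
      exact ⟨fun _ => rfl, le_sqrt_two_add_one_mul_sqrt (by linarith) (by linarith)⟩
    · rw [max_eq_left hZ.le] at hz1 ⊢
      refine ⟨fun h => by linarith, ?_⟩
      linarith [div_sqrt_le_mul_sqrt_add_sub_sqrt (by linarith) hz0 hz1]
end

section
/- Let P be a finite set of cardinality n ≥ 1 (indexing state-action pairs), let m ≥ 1 be a number of episodes, and for each episode k ∈ {1,...,m} and each p ∈ P let ν_k(p) ≥ 0 be a real number (the visitation count of p during episode k). Define N_k(p) = ∑_{j=1}^{k−1} ν_j(p). Suppose ν_k(p) ≤ max{N_k(p), 1} for all k and p, and suppose the total count satisfies ∑_{k=1}^{m} ∑_{p ∈ P} ν_k(p) ≤ T for some real T ≥ n. Then ∑_{k=1}^{m} ∑_{p ∈ P} ν_k(p) / √(max{N_k(p), 1}) ≤ (√2 + 1)·√(n·T). -/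
/-- One step of the square-root summation bound: adding `x / √N` to a sum is paid for by the
growth of `(√2 + 1) * √N` as long as `x ≤ N`. -/
lemma div_sqrt_le_sqrt_add_sub_sqrt {N x : ℝ} (hN : 0 < N) (hx : 0 ≤ x) (hxN : x ≤ N) :
    x / √N ≤ (√2 + 1) * (√(N + x) - √N) := by
  have hsq : 0 < √N := Real.sqrt_pos.2 hN
  have hmono : √N ≤ √(N + x) := Real.sqrt_le_sqrt (by linarith)
  have hdouble : √(N + x) ≤ √2 * √N := by
    rw [← Real.sqrt_mul (by norm_num)]
    exact Real.sqrt_le_sqrt (by linarith)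
  have h₁ : √N ^ 2 = N := Real.sq_sqrt hN.le
  have h₂ : √(N + x) ^ 2 = N + x := Real.sq_sqrt (by linarith)
  rw [div_le_iff₀ hsq]
  nlinarith [mul_nonneg (sub_nonneg.2 hmono) (sub_nonneg.2 hdouble)]

/-- If each `a k ≥ 0` is at most the maximum of `1` and the sum of the preceding terms, then
`∑ a k / √(max (∑ j < k, a j) 1)` is at most `√2 + 1` times the square root of `∑ a k`. -/
lemma sum_div_sqrt_max_sum_le (a : ℕ → ℝ) (m : ℕ)
    (ha : ∀ k, 1 ≤ k → k ≤ m → 0 ≤ a k)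
    (hle : ∀ k, 1 ≤ k → k ≤ m → a k ≤ max (∑ j ∈ Finset.Ico 1 k, a j) 1) :
    ∑ k ∈ Finset.Icc 1 m, a k / √(max (∑ j ∈ Finset.Ico 1 k, a j) 1)
      ≤ (√2 + 1) * √(∑ k ∈ Finset.Icc 1 m, a k) := by
  suffices h : ∑ k ∈ Finset.Icc 1 m, a k / √(max (∑ j ∈ Finset.Ico 1 k, a j) 1)
        ≤ (√2 + 1) * √(∑ k ∈ Finset.Icc 1 m, a k) ∧
      (∑ k ∈ Finset.Icc 1 m, a k < 1 →
        ∑ k ∈ Finset.Icc 1 m, a k / √(max (∑ j ∈ Finset.Ico 1 k, a j) 1)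
          ≤ ∑ k ∈ Finset.Icc 1 m, a k) from h.1
  induction m with
  | zero => simp
  | succ m ih =>
    obtain ⟨ih₁, ih₂⟩ := ih (fun k h₁ h₂ => ha k h₁ (by omega)) fun k h₁ h₂ => hle k h₁ (by omega)
    have hN : 0 ≤ ∑ k ∈ Finset.Icc 1 m, a k := Finset.sum_nonneg fun k hk => by
      rw [Finset.mem_Icc] at hk
      exact ha k hk.1 (by omega)
    have hx := ha (m + 1) (by omega) le_rfl
    have hxle := hle (m + 1) (by omega) le_rfl
    have hIco : Finset.Ico 1 (m + 1) = Finset.Icc 1 m := by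
      ext k
      simp only [Finset.mem_Ico, Finset.mem_Icc]
      omega
    rw [Finset.sum_Icc_succ_top (by omega), Finset.sum_Icc_succ_top (by omega)]
    rw [hIco] at hxle ⊢
    generalize ∑ k ∈ Finset.Icc 1 m, a k / √(max (∑ j ∈ Finset.Ico 1 k, a j) 1) = S at *
    generalize ∑ k ∈ Finset.Icc 1 m, a k = N at *
    generalize a (m + 1) = x at *
    rcases lt_or_ge N 1 with h | h
    · rw [max_eq_right h.le] at hxle ⊢
      have hS := ih₂ h
      rw [Real.sqrt_one, div_one]
      refine ⟨?_, fun _ => by linarith⟩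
      have hsq : √(N + x) ^ 2 = N + x := Real.sq_sqrt (by linarith)
      have hsqrt : √(N + x) ≤ √2 := Real.sqrt_le_sqrt (by linarith)
      nlinarith [Real.sqrt_nonneg (N + x)]
    · rw [max_eq_left h] at hxle ⊢
      have := div_sqrt_le_sqrt_add_sub_sqrt (by linarith) hx hxle
      exact ⟨by linarith, fun h' => by linarith⟩

/-- Cauchy–Schwarz for a sum of square roots. -/
lemma sum_sqrt_le_sqrt_card_mul_sum {ι : Type*} [Fintype ι] (f : ι → ℝ) (hf : ∀ i, 0 ≤ f i) :
    ∑ i, √(f i) ≤ √(Fintype.card ι * ∑ i, f i) := by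
  apply Real.le_sqrt_of_sq_le
  have := sq_sum_le_card_mul_sum_sq (s := Finset.univ) (f := fun i => √(f i))
  simpa only [Real.sq_sqrt (hf _), Finset.card_univ] using this

/-- **Visitation-count sum bound over episodes (Lemma 6, step 8).**
Let `P` be a finite set of `n ≥ 1` state-action pairs, let `m ≥ 1` be the number of
episodes, and let `ν k p ≥ 0` be the visitation count of `p` in episode `k`, with
`N k p = ∑_{j=1}^{k-1} ν j p` the count before episode `k`.  If the episode-stopping
rule guarantees `ν k p ≤ max (N k p) 1` for all `1 ≤ k ≤ m`, `p`, and the total count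
satisfies `∑_{k=1}^{m} ∑_{p} ν k p ≤ T` with `T ≥ n`, then
`∑_{k=1}^{m} ∑_{p} ν k p / √(max (N k p) 1) ≤ (√2 + 1) * √(n * T)`. -/
theorem visitation_count_sum_bound
    {P : Type*} [Fintype P] (n : ℕ) (hcard : Fintype.card P = n) (hn : 1 ≤ n)
    (m : ℕ) (hm : 1 ≤ m) (ν : ℕ → P → ℝ) (T : ℝ) (hT : (n : ℝ) ≤ T)
    (hν_nonneg : ∀ k p, 1 ≤ k → k ≤ m → 0 ≤ ν k p)
    (hν_le : ∀ k p, 1 ≤ k → k ≤ m →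
      ν k p ≤ max (∑ j ∈ Finset.Ico 1 k, ν j p) 1)
    (h_total : ∑ k ∈ Finset.Icc 1 m, ∑ p : P, ν k p ≤ T) :
    ∑ k ∈ Finset.Icc 1 m, ∑ p : P,
        ν k p / Real.sqrt (max (∑ j ∈ Finset.Ico 1 k, ν j p) 1)
      ≤ (Real.sqrt 2 + 1) * Real.sqrt (n * T) := by
  rw [Finset.sum_comm] at h_total ⊢
  have hnonneg : ∀ p, 0 ≤ ∑ k ∈ Finset.Icc 1 m, ν k p := fun p => Finset.sum_nonneg fun k hk =>
    hν_nonneg k p (Finset.mem_Icc.1 hk).1 (Finset.mem_Icc.1 hk).2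
  calc
    _ ≤ ∑ p, (√2 + 1) * √(∑ k ∈ Finset.Icc 1 m, ν k p) :=
      Finset.sum_le_sum fun p _ => sum_div_sqrt_max_sum_le (fun k => ν k p) m
        (fun k => hν_nonneg k p) fun k => hν_le k p
    _ = (√2 + 1) * ∑ p, √(∑ k ∈ Finset.Icc 1 m, ν k p) := (Finset.mul_sum ..).symm
    _ ≤ (√2 + 1) * √(n * ∑ p, ∑ k ∈ Finset.Icc 1 m, ν k p) := by
      rw [← hcard]
      gcongr
      exact sum_sqrt_le_sqrt_card_mul_sum _ hnonneg
    _ ≤ (√2 + 1) * √(n * T) := by gcongr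
end

section
/- Let P be a finite set of cardinality n ≥ 1 (indexing state-action pairs), let m ≥ 1 be a number of episodes, and for each episode k ∈ {1,...,m} and p ∈ P let ν_k(p) ∈ ℕ be the visitation count of p in episode k, with N_k(p) = ∑_{j=1}^{k−1} ν_j(p). Suppose that every episode k ∈ {1,...,m} ends by the doubling criterion, i.e., there exists p ∈ P with ν_k(p) ≥ max{N_k(p), 1}, and that the total number of steps satisfies ∑_{k=1}^{m} ∑_{p ∈ P} ν_k(p) ≤ T for some integer T ≥ n. Then the number of episodes satisfies m ≤ n·log₂(8T/n). -/
/-- When each of `m` episodes doubles some pair, the product over pairs of `max (2 N) 1`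
has at least doubled `m` times. -/
theorem two_pow_le_prod_max_of_doubling {P : Type*} [Fintype P] (ν : ℕ → P → ℕ) (m : ℕ)
    (h : ∀ k, 1 ≤ k → k ≤ m → ∃ p : P, max (∑ j ∈ Finset.Ico 1 k, ν j p) 1 ≤ ν k p) :
    2 ^ m ≤ ∏ p : P, max (2 * ∑ j ∈ Finset.Icc 1 m, ν j p) 1 := by
  classical
  induction m with
  | zero => simp
  | succ m ih =>
    obtain ⟨p, hp⟩ := h (m + 1) (by omega) le_rfl
    have hIco : Finset.Ico 1 (m + 1) = Finset.Icc 1 m := by ext; simp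
    rw [hIco] at hp
    have hsum (q : P) : ∑ j ∈ Finset.Icc 1 (m + 1), ν j q =
        ∑ j ∈ Finset.Icc 1 m, ν j q + ν (m + 1) q :=
      Finset.sum_Icc_succ_top (by omega) _
    calc 2 ^ (m + 1) = 2 * 2 ^ m := pow_succ' 2 m
      _ ≤ 2 * ∏ q : P, max (2 * ∑ j ∈ Finset.Icc 1 m, ν j q) 1 := by
        gcongr
        exact ih fun k h1 h2 => h k h1 (by omega)
      _ ≤ ∏ q : P, max (2 * ∑ j ∈ Finset.Icc 1 (m + 1), ν j q) 1 := by
        rw [← Finset.mul_prod_erase _ _ (Finset.mem_univ p),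
          ← Finset.mul_prod_erase _ (fun q => max (2 * ∑ j ∈ Finset.Icc 1 (m + 1), ν j q) 1)
            (Finset.mem_univ p), ← mul_assoc]
        refine Nat.mul_le_mul ?_ (Finset.prod_le_prod' fun q _ => ?_)
        · rw [hsum]
          omega
        · rw [hsum]
          omega

/-- A form of the inequality of arithmetic and geometric means: if positive reals have mean at
most `a`, then their geometric mean is at most `a`. -/
theorem sum_log_le_card_mul_log {P : Type*} [Fintype P] {x : P → ℝ} (hx : ∀ p, 0 < x p)
    {a : ℝ} (ha : 0 < a) (h : ∑ p, x p ≤ Fintype.card P * a) :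
    ∑ p, Real.log (x p) ≤ Fintype.card P * Real.log a := by
  have hlog (p : P) : Real.log (x p) ≤ x p / a - 1 + Real.log a := by
    have := Real.log_le_sub_one_of_pos (div_pos (hx p) ha)
    rw [Real.log_div (hx p).ne' ha.ne'] at this
    linarith
  have hdiv : (∑ p, x p) / a ≤ Fintype.card P := (div_le_iff₀ ha).2 h
  calc ∑ p, Real.log (x p) ≤ ∑ p, (x p / a - 1 + Real.log a) :=
        Finset.sum_le_sum fun p _ => hlog p
    _ = (∑ p, x p) / a - Fintype.card P + Fintype.card P * Real.log a := by
        simp [Finset.sum_add_distrib, Finset.sum_sub_distrib, Finset.sum_div]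
    _ ≤ _ := by linarith

/-- **Bound on the number of episodes (Lemma 6 of the paper).**
Let `P` be a finite set of `n ≥ 1` state-action pairs and let `ν k p ∈ ℕ` be the
visitation count of `p` in episode `k`, with `N k p = ∑_{j=1}^{k-1} ν j p` the count
before episode `k`.  If every episode `1 ≤ k ≤ m` ends by the doubling criterion, i.e.
some pair `p` satisfies `ν k p ≥ max (N k p) 1`, and the total number of steps
satisfies `∑_{k=1}^{m} ∑_{p} ν k p ≤ T` with `T ≥ n`, then the number of episodes
satisfies `m ≤ n * log₂ (8 * T / n)`. -/
theorem number_of_episodes_bound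
    {P : Type*} [Fintype P] (n : ℕ) (hcard : Fintype.card P = n) (hn : 1 ≤ n)
    (m : ℕ) (hm : 1 ≤ m) (ν : ℕ → P → ℕ) (T : ℕ) (hT : n ≤ T)
    (h_doubling : ∀ k, 1 ≤ k → k ≤ m →
      ∃ p : P, max (∑ j ∈ Finset.Ico 1 k, ν j p) 1 ≤ ν k p)
    (h_total : ∑ k ∈ Finset.Icc 1 m, ∑ p : P, ν k p ≤ T) :
    (m : ℝ) ≤ (n : ℝ) * Real.logb 2 (8 * T / n) := by
  subst hcard
  have hn' : (0 : ℝ) < Fintype.card P := by exact_mod_cast hn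
  have hT' : (0 : ℝ) < T := by exact_mod_cast hn.trans hT
  have hsum : ∑ p : P, max (2 * ∑ j ∈ Finset.Icc 1 m, ν j p) 1 ≤ 8 * T := by
    rw [Finset.sum_comm] at h_total
    calc ∑ p : P, max (2 * ∑ j ∈ Finset.Icc 1 m, ν j p) 1
        ≤ ∑ p : P, (2 * ∑ j ∈ Finset.Icc 1 m, ν j p + 1) :=
          Finset.sum_le_sum fun p _ => by omega
      _ = 2 * ∑ p : P, ∑ j ∈ Finset.Icc 1 m, ν j p + Fintype.card P := by
          simp [Finset.sum_add_distrib, Finset.mul_sum]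
      _ ≤ 8 * T := by omega
  have hpos (p : P) : (0 : ℝ) < (max (2 * ∑ j ∈ Finset.Icc 1 m, ν j p) 1 : ℕ) := by
    exact_mod_cast Nat.lt_of_lt_of_le one_pos (le_max_right _ _)
  have hlog := sum_log_le_card_mul_log hpos (a := 8 * T / Fintype.card P) (by positivity) (by
    rw [mul_div_cancel₀ _ hn'.ne']
    exact_mod_cast hsum)
  have hprod : (2 : ℝ) ^ m ≤
      ∏ p : P, ((max (2 * ∑ j ∈ Finset.Icc 1 m, ν j p) 1 : ℕ) : ℝ) := by
    exact_mod_cast two_pow_le_prod_max_of_doubling ν m h_doubling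
  have hlog_prod := Real.log_le_log (by positivity) hprod
  rw [Real.log_pow, Real.log_prod fun p _ => (hpos p).ne'] at hlog_prod
  rw [Real.logb, ← mul_div_assoc, le_div_iff₀ (Real.log_pos one_lt_two)]
  exact hlog_prod.trans hlog
end
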